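/- arXiv:1602.02138 — 2 statements merged into one kernel-verified Lean document; each statement's English description precedes it below -/
import Mathlib

section
/- Let {a_n}_{n≥0} be periodic with minimal odd period p, 0 < a_i < 2 for i = 0, …, p−1, and set σ = Σ_{j=1}^{p} (−1)^j a_{j−1}. If the initial values satisfy x_{−1} > 0 and x_0 = x_{−1}·e^{−σ/2 − x_{−1}} (equivalently t_0 = e^{−σ/2}), then the solution {x_n} of x_{n+1} = x_{n−1}·exp(a_n − x_{n−1} − x_n) converges to a periodic solution of period p: there exists a solution {x̄_n} with x̄_{n+p} = x̄_n for all n such that |x_n − x̄_n| → 0 as n → ∞. -/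
open Filter Topology

/-! ### Elementary inequalities -/

lemma two_sub_mul_exp_le {t : ℝ} (ht : 0 ≤ t) : (2 - t) * Real.exp t ≤ 2 + t := by
  have hd : ∀ x : ℝ, HasDerivAt (fun x : ℝ => (2 + x) * Real.exp (-x) + x)
      (1 * Real.exp (-x) + (2 + x) * (Real.exp (-x) * (-1)) + 1) x := fun x =>
    (((hasDerivAt_id x).const_add 2).mul (hasDerivAt_neg x).exp).add (hasDerivAt_id x)
  have hmono : Monotone (fun x : ℝ => (2 + x) * Real.exp (-x) + x) := by
    refine monotone_of_deriv_nonneg (fun x => (hd x).differentiableAt) fun x => ?_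
    rw [(hd x).deriv]
    have h1 := Real.add_one_le_exp x
    have h2 : Real.exp x * Real.exp (-x) = 1 := by rw [← Real.exp_add]; simp
    nlinarith [Real.exp_pos (-x)]
  have h := hmono ht
  simp only [add_zero, neg_zero, Real.exp_zero, mul_one] at h
  have h2 : Real.exp t * Real.exp (-t) = 1 := by rw [← Real.exp_add]; simp
  nlinarith [Real.exp_pos t]

lemma mul_exp_two_sub_le {w : ℝ} (hw : 0 ≤ w) : w * Real.exp (2 - w) ≤ 2 + w := by
  have h1 := Real.quadratic_le_exp_of_nonneg hw
  have h2 : Real.exp 2 ≤ 7.39 := by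
    have h : Real.exp 2 = Real.exp 1 * Real.exp 1 := by rw [← Real.exp_add]; norm_num
    have := Real.exp_one_lt_d9
    rw [h]; nlinarith [Real.exp_pos 1]
  rw [Real.exp_sub, ← mul_div_assoc, div_le_iff₀ (Real.exp_pos w)]
  have h3 : w * Real.exp 2 ≤ w * 7.39 := mul_le_mul_of_nonneg_left h2 hw
  have h4 : (2 + w) * (1 + w + w ^ 2 / 2) ≤ (2 + w) * Real.exp w :=
    mul_le_mul_of_nonneg_left h1 (by linarith)
  have h5 : w * 7.39 ≤ (2 + w) * (1 + w + w ^ 2 / 2) := by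
    nlinarith [mul_nonneg (sq_nonneg (w - 0.85)) (by linarith : 0 ≤ w + 1.7),
      sq_nonneg (w - 0.8266)]
  linarith

lemma exp_le_two_add {t : ℝ} (h0 : 0 ≤ t) (h1 : t ≤ 1) : Real.exp t ≤ 2 + t := by
  have h := Real.abs_exp_sub_one_sub_id_le (x := t) (by rw [abs_of_nonneg h0]; exact h1)
  have := (abs_le.1 h).2
  nlinarith

lemma mul_exp_sub_two_le {x t : ℝ} (hx : 0 ≤ x) (hx1 : x ≤ 1) (ht : 0 ≤ t) (hxt : x ≤ 2 - t) :
    x * (Real.exp t - 2) ≤ t := by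
  rcases le_total (Real.exp t) 2 with h | h
  · nlinarith
  rcases le_total t 1 with h1 | h1
  · nlinarith [exp_le_two_add ht h1]
  · have h2 := mul_exp_two_sub_le (w := 2 - t) (by linarith)
    rw [sub_sub_cancel] at h2
    nlinarith

lemma sub_one_le_exp_sub_two (x : ℝ) : x - 1 ≤ Real.exp (x - 2) := by
  linarith [Real.add_one_le_exp (x - 2)]

/-- The weight `exp (max 0 (x + y - 2))` is strictly contracted along the second-order recursion. -/
lemma abs_one_sub_mul_exp_lt {x y a : ℝ} (hx : 0 < x) (hy : 0 < y) (ha : a < 2) :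
    |1 - x| * Real.exp (max 0 (y + x * Real.exp (a - x - y) - 2)) <
      Real.exp (max 0 (x + y - 2)) := by
  have hz : x * Real.exp (a - x - y) < x * Real.exp (2 - x - y) :=
    mul_lt_mul_of_pos_left (Real.exp_lt_exp.2 (by linarith)) hx
  set z := x * Real.exp (a - x - y) with hzdef
  have key : ∀ c e : ℝ, |1 - x| ≤ Real.exp c → c + max 0 (y + z - 2) < e →
      |1 - x| * Real.exp (max 0 (y + z - 2)) < Real.exp e := by
    intro c e h1 h2
    calc _ ≤ Real.exp c * Real.exp (max 0 (y + z - 2)) :=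
          mul_le_mul_of_nonneg_right h1 (Real.exp_pos _).le
      _ = Real.exp (c + max 0 (y + z - 2)) := (Real.exp_add _ _).symm
      _ < _ := Real.exp_lt_exp.2 h2
  have habs1 : 1 ≤ x → |1 - x| ≤ Real.exp (x - 2) := fun h => by
    rw [abs_of_nonpos (by linarith)]; linarith [sub_one_le_exp_sub_two x]
  have habs2 : x ≤ 1 → |1 - x| ≤ Real.exp (-x) := fun h => by
    rw [abs_of_nonneg (by linarith)]; linarith [Real.add_one_le_exp (-x)]
  have hm0 : 0 ≤ max 0 (x + y - 2) := le_max_left _ _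
  have hm1 : x + y - 2 ≤ max 0 (x + y - 2) := le_max_right _ _
  rcases le_or_gt (y + z) 2 with hA | hA
  · have hmz : max 0 (y + z - 2) = 0 := max_eq_left (by linarith)
    rcases le_total x 1 with h | h
    · exact key _ _ (habs2 h) (by rw [hmz]; linarith)
    · rcases lt_or_ge x 2 with h2 | h2
      · exact key _ _ (habs1 h) (by rw [hmz]; linarith)
      · exact key _ _ (habs1 h) (by rw [hmz]; linarith)
  have hmz : max 0 (y + z - 2) = y + z - 2 := max_eq_right (by linarith)
  rcases le_or_gt 2 (x + y) with hd | hd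
  · have hzx : z < x := by
      refine hz.trans_le ?_
      have : Real.exp (2 - x - y) ≤ 1 := Real.exp_le_one_iff.2 (by linarith)
      nlinarith
    rcases le_or_gt x 1 with h | h
    · exact key _ _ (habs2 h) (by rw [hmz]; linarith)
    rcases le_or_gt x 2 with h2 | h2
    · exact key _ _ (habs1 h.le) (by rw [hmz]; linarith)
    · refine key _ _ (habs1 h.le) ?_
      have hz2 : z < 2 := by
        refine hz.trans_le ?_
        have h3 : Real.exp (2 - x - y) ≤ Real.exp (2 - x) := Real.exp_le_exp.2 (by linarith)
        have h4 : Real.exp (2 - x) * Real.exp (x - 2) = 1 := by rw [← Real.exp_add]; simp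
        have h5 := sub_one_le_exp_sub_two x
        have h6 : x * Real.exp (2 - x) ≤ 2 := by
          nlinarith [Real.exp_pos (2 - x)]
        nlinarith
      rw [hmz]; linarith
  · obtain ⟨t, ht⟩ : ∃ t, t = 2 - x - y := ⟨_, rfl⟩
    rw [← ht] at hz
    rcases le_or_gt x 1 with h | h
    · refine key _ _ (habs2 h) ?_
      have := mul_exp_sub_two_le hx.le h (t := t) (by linarith) (by linarith)
      rw [hmz]; linarith
    · refine key _ _ (habs1 h.le) ?_
      have h1 := two_sub_mul_exp_le (t := t) (by linarith)
      have h2 : x * Real.exp t ≤ (2 - t) * Real.exp t :=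
        mul_le_mul_of_nonneg_right (by linarith) (Real.exp_pos _).le
      rw [hmz]; linarith

/-! ### The Ricker map in logarithmic coordinates and a contracted distance -/

/-- The Ricker map `x ↦ x * exp (c - x)` in the coordinate `u = log x`. -/
noncomputable def logRicker (c u : ℝ) : ℝ := u + c - Real.exp u

/-- The density, in the coordinate `u = log x`, of the metric contracted by Ricker maps. -/
noncomputable def rickerWeight (c u : ℝ) : ℝ :=
  Real.exp (max 0 (Real.exp u + Real.exp (logRicker c u) - 2))

/-- A primitive of `rickerWeight`. -/
noncomputable def rickerPrimitive (c u : ℝ) : ℝ := ∫ v in (0 : ℝ)..u, rickerWeight c v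

lemma continuous_logRicker (c : ℝ) : Continuous (logRicker c) := by
  unfold logRicker; fun_prop

lemma continuous_rickerWeight (c : ℝ) : Continuous (rickerWeight c) := by
  have := continuous_logRicker c
  unfold rickerWeight; fun_prop

lemma hasDerivAt_logRicker (c u : ℝ) : HasDerivAt (logRicker c) (1 - Real.exp u) u :=
  ((hasDerivAt_id u).add_const c).sub (Real.hasDerivAt_exp u)

lemma hasDerivAt_rickerPrimitive (c u : ℝ) :
    HasDerivAt (rickerPrimitive c) (rickerWeight c u) u :=
  (continuous_rickerWeight c).integral_hasStrictDerivAt 0 u |>.hasDerivAt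

lemma continuous_rickerPrimitive (c : ℝ) : Continuous (rickerPrimitive c) :=
  continuous_iff_continuousAt.2 fun u => (hasDerivAt_rickerPrimitive c u).continuousAt

lemma one_le_rickerWeight (c u : ℝ) : 1 ≤ rickerWeight c u :=
  Real.one_le_exp (le_max_left _ _)

lemma exp_logRicker (c u : ℝ) :
    Real.exp (logRicker c u) = Real.exp u * Real.exp (c - Real.exp u) := by
  rw [← Real.exp_add, logRicker, add_sub_assoc]

lemma abs_mul_rickerWeight_lt {c c' : ℝ} (h : c + c' < 2) (u : ℝ) :
    |1 - Real.exp u| * rickerWeight c' (logRicker c u) < rickerWeight c u := by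
  have hz : Real.exp (logRicker c' (logRicker c u)) =
      Real.exp u * Real.exp (c + c' - Real.exp u - Real.exp (logRicker c u)) := by
    rw [← Real.exp_add]
    congr 1
    rw [logRicker, logRicker]
    ring
  have := abs_one_sub_mul_exp_lt (Real.exp_pos u) (Real.exp_pos (logRicker c u)) h
  rwa [← hz] at this

/-- A function whose increments are dominated by those of `g` in both directions. -/
lemma abs_sub_lt_of_strictMono {f g : ℝ → ℝ} (hadd : StrictMono fun u => g u + f u)
    (hsub : StrictMono fun u => g u - f u) {u v : ℝ} (huv : u ≠ v) :
    |f u - f v| < |g u - g v| := by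
  rcases huv.lt_or_gt with h | h
  · have h1 := hadd h
    have h2 := hsub h
    simp only at h1 h2
    refine (abs_lt.2 ⟨?_, ?_⟩).trans_le (neg_le_abs _) <;> linarith
  · have h1 := hadd h
    have h2 := hsub h
    simp only at h1 h2
    refine (abs_lt.2 ⟨?_, ?_⟩).trans_le (le_abs_self _) <;> linarith

lemma abs_rickerPrimitive_logRicker_lt {c c' : ℝ} (h : c + c' < 2) {u v : ℝ} (huv : u ≠ v) :
    |rickerPrimitive c' (logRicker c u) - rickerPrimitive c' (logRicker c v)| <
      |rickerPrimitive c u - rickerPrimitive c v| := by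
  have hf : ∀ u, HasDerivAt (fun u => rickerPrimitive c' (logRicker c u))
      (rickerWeight c' (logRicker c u) * (1 - Real.exp u)) u := fun u =>
    (hasDerivAt_rickerPrimitive c' _).comp u (hasDerivAt_logRicker c u)
  have hlt : ∀ u, |rickerWeight c' (logRicker c u) * (1 - Real.exp u)| < rickerWeight c u := by
    intro u
    rw [abs_mul, abs_of_pos (zero_lt_one.trans_le (one_le_rickerWeight _ _)), mul_comm]
    exact abs_mul_rickerWeight_lt h u
  refine abs_sub_lt_of_strictMono (f := fun u => rickerPrimitive c' (logRicker c u))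
    (g := rickerPrimitive c) ?_ ?_ huv
  · refine strictMono_of_deriv_pos fun u => ?_
    rw [((hasDerivAt_rickerPrimitive c u).fun_add (hf u)).deriv]
    linarith [(abs_lt.1 (hlt u)).1]
  · refine strictMono_of_deriv_pos fun u => ?_
    rw [((hasDerivAt_rickerPrimitive c u).fun_sub (hf u)).deriv]
    linarith [(abs_lt.1 (hlt u)).2]

lemma abs_sub_le_abs_rickerPrimitive_sub (c u v : ℝ) :
    |u - v| ≤ |rickerPrimitive c u - rickerPrimitive c v| := by
  have hmono : Monotone fun u => rickerPrimitive c u - u := by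
    have hd := fun u => (hasDerivAt_rickerPrimitive c u).fun_sub (hasDerivAt_id' u)
    refine monotone_of_deriv_nonneg (fun u => (hd u).differentiableAt) fun u => ?_
    rw [(hd u).deriv]
    linarith [one_le_rickerWeight c u]
  rcases le_total u v with h | h
  · have := hmono h
    simp only at this
    rw [abs_of_nonpos (by linarith)]
    exact le_trans (by linarith) (neg_le_abs _)
  · have := hmono h
    simp only at this
    rw [abs_of_nonneg (by linarith)]
    exact le_trans (by linarith) (le_abs_self _)

/-! ### Orbits of periodic compositions of Ricker maps -/

/-- The orbit of `u` under the maps `logRicker (s 0)`, `logRicker (s 1)`, …. -/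
noncomputable def logOrbit (s : ℕ → ℝ) (u : ℝ) : ℕ → ℝ
  | 0 => u
  | n + 1 => logRicker (s n) (logOrbit s u n)

lemma continuous_logOrbit (s : ℕ → ℝ) (n : ℕ) : Continuous fun u => logOrbit s u n := by
  induction n with
  | zero => exact continuous_id
  | succ n ih => exact (continuous_logRicker (s n)).comp ih

lemma logOrbit_eq (s : ℕ → ℝ) (u : ℝ) (n : ℕ) :
    logOrbit s u n = u + ∑ i ∈ Finset.range n, s i -
      ∑ i ∈ Finset.range n, Real.exp (logOrbit s u i) := by
  induction n with
  | zero => simp [logOrbit]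
  | succ n ih =>
    rw [Finset.sum_range_succ, Finset.sum_range_succ, logOrbit, logRicker]
    linarith

lemma logOrbit_add {s : ℕ → ℝ} {p : ℕ} (hs : Function.Periodic s p) (u : ℝ) (n : ℕ) :
    logOrbit s u (n + p) = logOrbit s (logOrbit s u p) n := by
  induction n with
  | zero => rw [Nat.zero_add]; rfl
  | succ n ih => rw [Nat.succ_add, logOrbit, logOrbit, ih, hs n]

lemma tendsto_exp_logOrbit_atBot (s : ℕ → ℝ) (n : ℕ) :
    Tendsto (fun u => Real.exp (logOrbit s u n)) atBot (𝓝 0) := by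
  refine Real.tendsto_exp_atBot.comp ?_
  refine tendsto_atBot_mono (f := fun u => u + ∑ i ∈ Finset.range n, s i) (fun u => ?_)
    (tendsto_atBot_add_const_right _ _ tendsto_id)
  rw [logOrbit_eq]
  linarith [Finset.sum_nonneg fun i (_ : i ∈ Finset.range n) => (Real.exp_pos (logOrbit s u i)).le]

lemma exists_logOrbit_eq_self {s : ℕ → ℝ} {p : ℕ} (hp : 0 < p)
    (hs : 0 < ∑ i ∈ Finset.range p, s i) : ∃ u, logOrbit s u p = u := by
  have hlim : Tendsto (fun u => ∑ i ∈ Finset.range p, Real.exp (logOrbit s u i)) atBot (𝓝 0) := by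
    simpa using tendsto_finsetSum (Finset.range p) fun i _ => tendsto_exp_logOrbit_atBot s i
  obtain ⟨v, hv⟩ := (hlim.eventually (gt_mem_nhds hs)).exists
  set S := ∑ i ∈ Finset.range p, s i with hS
  have hlow : S ≤ ∑ i ∈ Finset.range p, Real.exp (logOrbit s S i) := by
    refine le_trans ?_ (Finset.single_le_sum (fun i _ => (Real.exp_pos (logOrbit s S i)).le)
      (Finset.mem_range.2 hp))
    have := Real.add_one_le_exp S
    change S ≤ Real.exp S
    linarith
  have hcont : Continuous fun u => logOrbit s u p - u := (continuous_logOrbit s p).sub continuous_id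
  obtain ⟨u, hu⟩ := mem_range_of_exists_le_of_exists_ge (c := 0) hcont
    ⟨S, by rw [logOrbit_eq s S p]; linarith⟩ ⟨v, by rw [logOrbit_eq s v p]; linarith⟩
  exact ⟨u, sub_eq_zero.1 hu⟩

section Convergence

variable {s : ℕ → ℝ} {p : ℕ}

lemma antitone_abs_rickerPrimitive_sub (hlt : ∀ n, s n + s (n + 1) < 2) (u v : ℝ) :
    Antitone fun n =>
      |rickerPrimitive (s n) (logOrbit s u n) - rickerPrimitive (s n) (logOrbit s v n)| := by
  refine antitone_nat_of_succ_le fun n => ?_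
  by_cases h : logOrbit s u n = logOrbit s v n
  · simp [logOrbit, h]
  · exact (abs_rickerPrimitive_logRicker_lt (hlt n) h).le

lemma abs_rickerPrimitive_logOrbit_lt (hp : 0 < p) (hs : Function.Periodic s p)
    (hlt : ∀ n, s n + s (n + 1) < 2) {u v : ℝ} (huv : u ≠ v) :
    |rickerPrimitive (s 0) (logOrbit s u p) - rickerPrimitive (s 0) (logOrbit s v p)| <
      |rickerPrimitive (s 0) u - rickerPrimitive (s 0) v| := by
  have h1 := antitone_abs_rickerPrimitive_sub hlt u v (Nat.succ_le_of_lt hp)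
  have h2 := abs_rickerPrimitive_logRicker_lt (hlt 0) huv
  simp only [hs.eq] at h1
  exact h1.trans_lt h2

lemma logOrbit_mul_add {u : ℝ} (hs : Function.Periodic s p) (k : ℕ) :
    logOrbit s u ((k + 1) * p) = logOrbit s (logOrbit s u (k * p)) p := by
  have hk : Function.Periodic s (k * p) := by simpa using hs.nat_mul k
  rw [Nat.succ_mul, Nat.add_comm, logOrbit_add hk]

lemma tendsto_logOrbit_sub (hp : 0 < p) (hs : Function.Periodic s p)
    (hlt : ∀ n, s n + s (n + 1) < 2) {v : ℝ} (hv : logOrbit s v p = v) (u : ℝ) :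
    Tendsto (fun n => logOrbit s u n - logOrbit s v n) atTop (𝓝 0) := by
  set D : ℕ → ℝ := fun n =>
    |rickerPrimitive (s n) (logOrbit s u n) - rickerPrimitive (s n) (logOrbit s v n)| with hD
  have hanti : Antitone D := antitone_abs_rickerPrimitive_sub hlt u v
  obtain ⟨c, hc⟩ : ∃ c, Tendsto D atTop (𝓝 c) :=
    ⟨_, tendsto_atTop_ciInf hanti ⟨0, by rintro _ ⟨n, rfl⟩; exact abs_nonneg _⟩⟩
  have hvk : ∀ k : ℕ, logOrbit s v (k * p) = v := by
    intro k
    induction k with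
    | zero => simp [logOrbit]
    | succ k ih => rw [logOrbit_mul_add hs, ih, hv]
  have hsk : ∀ k : ℕ, s (k * p) = s 0 := fun k => by simpa using hs.nat_mul_eq k
  set w : ℕ → ℝ := fun k => logOrbit s u (k * p) with hw
  have hDk : ∀ k, D (k * p) = |rickerPrimitive (s 0) (w k) - rickerPrimitive (s 0) v| := by
    intro k
    simp only [hD, hw, hvk, hsk]
  have hck : Tendsto (fun k => D (k * p)) atTop (𝓝 c) :=
    hc.comp (tendsto_id.atTop_mul_const' hp)
  have hwmem : ∀ k, w k ∈ Metric.closedBall v (D 0) := by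
    intro k
    rw [Metric.mem_closedBall, Real.dist_eq]
    calc _ ≤ _ := abs_sub_le_abs_rickerPrimitive_sub (s 0) _ _
      _ = D (k * p) := (hDk k).symm
      _ ≤ D 0 := hanti (Nat.zero_le _)
  obtain ⟨l, -, φ, hφ, hl⟩ := (isCompact_closedBall v (D 0)).tendsto_subseq hwmem
  have hdist : Continuous fun x => |rickerPrimitive (s 0) x - rickerPrimitive (s 0) v| :=
    ((continuous_rickerPrimitive (s 0)).sub continuous_const).abs
  have hcl : c = |rickerPrimitive (s 0) l - rickerPrimitive (s 0) v| := by
    refine tendsto_nhds_unique (hck.comp hφ.tendsto_atTop) ?_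
    refine ((hdist.tendsto l).comp hl).congr fun k => ?_
    exact (hDk _).symm
  have hcl' : c = |rickerPrimitive (s 0) (logOrbit s l p) - rickerPrimitive (s 0) v| := by
    refine tendsto_nhds_unique
      (((tendsto_add_atTop_iff_nat 1).2 hck).comp hφ.tendsto_atTop) ?_
    refine (((hdist.comp (continuous_logOrbit s p)).tendsto l).comp hl).congr fun k => ?_
    simp only [Function.comp_apply, hDk, hw, logOrbit_mul_add hs]
  have hlv : l = v := by
    by_contra hne
    have := abs_rickerPrimitive_logOrbit_lt hp hs hlt hne
    rw [hv, ← hcl, ← hcl'] at this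
    exact lt_irrefl _ this
  have hc0 : c = 0 := by simpa [hlv] using hcl
  rw [hc0] at hc
  exact squeeze_zero_norm (fun n => abs_sub_le_abs_rickerPrimitive_sub (s n) _ _) hc

lemma tendsto_exp_sub_exp {f g : ℕ → ℝ} {B : ℝ} (hB : ∀ n, g n ≤ B)
    (h : Tendsto (fun n => f n - g n) atTop (𝓝 0)) :
    Tendsto (fun n => Real.exp (f n) - Real.exp (g n)) atTop (𝓝 0) := by
  have h1 : Tendsto (fun n => Real.exp (f n - g n) - 1) atTop (𝓝 0) := by
    simpa using ((Real.continuous_exp.tendsto 0).comp h).sub_const 1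
  refine squeeze_zero_norm (a := fun n => Real.exp B * |Real.exp (f n - g n) - 1|)
    (fun n => ?_) (by simpa using h1.abs.const_mul (Real.exp B))
  have : Real.exp (f n) - Real.exp (g n) = Real.exp (g n) * (Real.exp (f n - g n) - 1) := by
    rw [mul_sub, ← Real.exp_add]; simp
  rw [this, Real.norm_eq_abs, abs_mul, Real.abs_exp]
  gcongr
  exact hB n

end Convergence

/-! ### The factor sequence -/

/-- The logarithms of the factor sequence: `s (n + 1) = a n - s n`. -/
noncomputable def logFactor (a : ℕ → ℝ) (c : ℝ) : ℕ → ℝ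
  | 0 => c
  | n + 1 => a n - logFactor a c n

lemma logFactor_add_succ (a : ℕ → ℝ) (c : ℝ) (n : ℕ) :
    logFactor a c n + logFactor a c (n + 1) = a n := by
  rw [logFactor]; ring

lemma logFactor_eq (a : ℕ → ℝ) (c : ℝ) (n : ℕ) :
    logFactor a c n = (-1) ^ n * (c + ∑ j ∈ Finset.Icc 1 n, (-1 : ℝ) ^ j * a (j - 1)) := by
  induction n with
  | zero => simp [logFactor]
  | succ n ih =>
    rw [logFactor, ih, Finset.sum_Icc_succ_top (by omega), Nat.add_sub_cancel]
    have h : ((-1 : ℝ) ^ n) * (-1) ^ n = 1 := by rw [← mul_pow]; simp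
    rw [pow_succ]
    linear_combination (-a n) * h

lemma periodic_logFactor {a : ℕ → ℝ} {p : ℕ} {σ : ℝ} (hodd : Odd p) (hper : Function.Periodic a p)
    (hσ : σ = ∑ j ∈ Finset.Icc 1 p, (-1 : ℝ) ^ j * a (j - 1)) :
    Function.Periodic (logFactor a (-σ / 2)) p := by
  intro n
  induction n with
  | zero =>
    rw [Nat.zero_add, logFactor_eq, ← hσ, hodd.neg_one_pow, logFactor]
    ring
  | succ n ih => rw [Nat.succ_add, logFactor, logFactor, ih, hper n]

lemma sum_logFactor_pos {a : ℕ → ℝ} {p : ℕ} {c : ℝ} (hp : 0 < p) (ha : ∀ n, 0 < a n)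
    (hs : Function.Periodic (logFactor a c) p) :
    0 < ∑ i ∈ Finset.range p, logFactor a c i := by
  have h1 : ∑ i ∈ Finset.range p, logFactor a c i + ∑ i ∈ Finset.range p, logFactor a c (i + 1) =
      ∑ i ∈ Finset.range p, a i := by
    rw [← Finset.sum_add_distrib]
    exact Finset.sum_congr rfl fun i _ => logFactor_add_succ a c i
  have h2 : 0 < ∑ i ∈ Finset.range p, a i :=
    Finset.sum_pos (fun i _ => ha i) (Finset.nonempty_range_iff.2 hp.ne')
  have h3 := Finset.sum_range_succ (logFactor a c) p
  rw [Finset.sum_range_succ', hs.eq] at h3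
  linarith

lemma exp_logOrbit_logFactor (a : ℕ → ℝ) (c u : ℝ) (n : ℕ) :
    Real.exp (logOrbit (logFactor a c) u (n + 2)) =
      Real.exp (logOrbit (logFactor a c) u n) *
        Real.exp (a n - Real.exp (logOrbit (logFactor a c) u n) -
          Real.exp (logOrbit (logFactor a c) u (n + 1))) := by
  rw [← Real.exp_add]
  congr 1
  have h1 : logOrbit (logFactor a c) u (n + 1) = logOrbit (logFactor a c) u n +
      logFactor a c n - Real.exp (logOrbit (logFactor a c) u n) := rfl
  have h2 : logOrbit (logFactor a c) u (n + 2) = logOrbit (logFactor a c) u (n + 1) +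
      logFactor a c (n + 1) - Real.exp (logOrbit (logFactor a c) u (n + 1)) := rfl
  linarith [logFactor_add_succ a c n]

lemma eq_exp_logOrbit {a X : ℕ → ℝ} {c : ℝ} (hx0 : 0 < X 0)
    (hx1 : X 1 = X 0 * Real.exp (c - X 0))
    (hrec : ∀ n : ℕ, X (n + 2) = X n * Real.exp (a n - X n - X (n + 1))) (n : ℕ) :
    X n = Real.exp (logOrbit (logFactor a c) (Real.log (X 0)) n) := by
  induction n using Nat.twoStepInduction with
  | zero => exact (Real.exp_log hx0).symm
  | one =>
    change X 1 = Real.exp (logRicker c (Real.log (X 0)))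
    rw [exp_logRicker, Real.exp_log hx0, hx1]
  | more n h0 h1 => rw [hrec, exp_logOrbit_logFactor, ← h0, ← h1]

/- Statement 12 (Corollary op(b)): {a_n} periodic with minimal odd period p, 0 < a_i < 2,
σ = Σ_{j=1}^p (-1)^j a_{j-1}.  If x_{-1} > 0 and x_0 = x_{-1} e^{-σ/2 - x_{-1}}, then the
solution converges to a periodic solution of period p.  We index X : ℕ → ℝ with
X n = x_{n-1}, so x_{-1} = X 0 and x_0 = X 1. -/
theorem stmt_12 (a : ℕ → ℝ) (p : ℕ) (hp : 0 < p) (hodd : Odd p)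
    (hper : Function.Periodic a p)
    (hmin : ∀ q : ℕ, 0 < q → Function.Periodic a q → p ≤ q)
    (ha : ∀ i : ℕ, i < p → 0 < a i ∧ a i < 2)
    (σ : ℝ) (hσ : σ = ∑ j ∈ Finset.Icc 1 p, (-1 : ℝ) ^ j * a (j - 1))
    (X : ℕ → ℝ) (hx0 : 0 < X 0)
    (hx1 : X 1 = X 0 * Real.exp (-σ / 2 - X 0))
    (hrec : ∀ n : ℕ, X (n + 2) = X n * Real.exp (a n - X n - X (n + 1))) :
    ∃ Y : ℕ → ℝ,
      (∀ n : ℕ, Y (n + 2) = Y n * Real.exp (a n - Y n - Y (n + 1))) ∧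
      (∀ n : ℕ, Y (n + p) = Y n) ∧
      Filter.Tendsto (fun n => |X n - Y n|) Filter.atTop (nhds 0) := by
  set s := logFactor a (-σ / 2) with hs
  have han : ∀ n, 0 < a n ∧ a n < 2 := fun n => by
    rw [← hper.map_mod_nat n]
    exact ha _ (Nat.mod_lt _ hp)
  have hsper : Function.Periodic s p := periodic_logFactor hodd hper hσ
  have hlt : ∀ n, s n + s (n + 1) < 2 := fun n => by
    rw [hs, logFactor_add_succ]
    exact (han n).2
  obtain ⟨v, hv⟩ := exists_logOrbit_eq_self hp (sum_logFactor_pos hp (fun n => (han n).1) hsper)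
  have hvper : Function.Periodic (logOrbit s v) p := fun n => by rw [logOrbit_add hsper, hv]
  have hbdd : ∀ n, logOrbit s v n ≤ ∑ i ∈ Finset.range p, |logOrbit s v i| := fun n => by
    rw [← hvper.map_mod_nat n]
    exact (le_abs_self _).trans (Finset.single_le_sum (f := fun i => |logOrbit s v i|)
      (fun i _ => abs_nonneg _) (Finset.mem_range.2 (Nat.mod_lt _ hp)))
  refine ⟨fun n => Real.exp (logOrbit s v n), exp_logOrbit_logFactor a _ v,
    fun n => congrArg Real.exp (hvper n), ?_⟩
  have h := (tendsto_exp_sub_exp hbdd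
    (tendsto_logOrbit_sub hp hsper hlt hv (Real.log (X 0)))).abs
  rw [abs_zero] at h
  exact h.congr fun n => by rw [← eq_exp_logOrbit hx0 hx1 hrec n]
end

section
/- Suppose {a_n}_{n≥0} is periodic with minimal even period p ≥ 2, set σ = Σ_{j=1}^{p} (−1)^j a_{j−1}, and let {t_n} be a solution of t_{n+1} = e^{a_n}/t_n with t_0 > 0. Then t_n = (t_0·exp(d_n σ + γ_n))^{(−1)^n} for all n, where d_n = ⌊n/p⌋ and γ_n = Σ_{j=1}^{n mod p} (−1)^j a_{j−1} (with γ_n = 0 when n mod p = 0). Moreover, {t_n} is periodic with period p if and only if σ = 0, i.e. if and only if a_0 + a_2 + … + a_{p−2} = a_1 + a_3 + … + a_{p−1}. -/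
/-- The alternating partial sum `∑_{j=1}^{n} (-1)^j a_{j-1}`. -/
def altSum (a : ℕ → ℝ) (n : ℕ) : ℝ :=
  ∑ j ∈ Finset.Icc 1 n, (-1 : ℝ) ^ j * a (j - 1)

@[simp]
lemma altSum_zero (a : ℕ → ℝ) : altSum a 0 = 0 := by
  simp [altSum]

lemma altSum_succ (a : ℕ → ℝ) (n : ℕ) :
    altSum a (n + 1) = altSum a n + (-1 : ℝ) ^ (n + 1) * a n := by
  simp [altSum, Finset.sum_Icc_succ_top]

lemma altSum_add_period {a : ℕ → ℝ} {p : ℕ} (heven : Even p) (hper : Function.Periodic a p)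
    (n : ℕ) : altSum a (n + p) = altSum a p + altSum a n := by
  induction n with
  | zero => simp
  | succ n ih =>
    rw [Nat.add_right_comm, altSum_succ, altSum_succ, ih, hper n, Nat.add_right_comm, pow_add,
      heven.neg_one_pow, mul_one, add_assoc]

lemma altSum_mul_period_add {a : ℕ → ℝ} {p : ℕ} (heven : Even p) (hper : Function.Periodic a p)
    (q r : ℕ) : altSum a (p * q + r) = q * altSum a p + altSum a r := by
  induction q with
  | zero => simp
  | succ q ih =>
    rw [Nat.mul_succ, Nat.add_right_comm, altSum_add_period heven hper, ih]
    push_cast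
    ring

lemma altSum_two_mul (a : ℕ → ℝ) (m : ℕ) :
    altSum a (2 * m) =
      ∑ i ∈ Finset.range m, a (2 * i + 1) - ∑ i ∈ Finset.range m, a (2 * i) := by
  induction m with
  | zero => simp
  | succ m ih =>
    rw [Nat.mul_succ, altSum_succ, altSum_succ, ih, Finset.sum_range_succ, Finset.sum_range_succ]
    simp only [pow_succ, pow_mul]
    norm_num
    ring

lemma factor_eq_zpow_altSum {a t : ℕ → ℝ} (htrec : ∀ n : ℕ, t (n + 1) = Real.exp (a n) / t n)
    (n : ℕ) : t n = (t 0 * Real.exp (altSum a n)) ^ ((-1 : ℤ) ^ n) := by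
  induction n with
  | zero => simp
  | succ n ih =>
    rw [htrec, ih, altSum_succ]
    rcases Nat.even_or_odd n with h | h
    · rw [h.neg_one_pow, h.add_one.neg_one_pow, h.add_one.neg_one_pow, zpow_one, zpow_neg_one,
        Real.exp_add, neg_one_mul, Real.exp_neg, mul_inv, mul_inv, inv_inv, div_eq_mul_inv,
        mul_inv]
      ring
    · rw [h.neg_one_pow, h.add_one.neg_one_pow, h.add_one.neg_one_pow, zpow_one, zpow_neg_one,
        Real.exp_add, one_mul, div_inv_eq_mul]
      ring

/- Statement 17 (Lemma pet): {a_n} periodic with minimal even period p ≥ 2,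
σ = Σ_{j=1}^p (-1)^j a_{j-1}, {t_n} a solution of t_{n+1} = e^{a_n}/t_n with t_0 > 0.
Then t_n = (t_0 exp(d_n σ + γ_n))^{(-1)^n} with d_n = ⌊n/p⌋ and
γ_n = Σ_{j=1}^{n mod p} (-1)^j a_{j-1} (γ_n = 0 when n mod p = 0; note the sum over the
empty range Icc 1 0 is 0).  Moreover {t_n} is periodic with period p iff σ = 0 iff
a_0 + a_2 + ... + a_{p-2} = a_1 + a_3 + ... + a_{p-1}. -/
theorem stmt_17 (a : ℕ → ℝ) (p : ℕ) (hp : 2 ≤ p) (heven : Even p)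
    (hper : Function.Periodic a p)
    (hmin : ∀ r : ℕ, 0 < r → Function.Periodic a r → p ≤ r)
    (σ : ℝ) (hσ : σ = ∑ j ∈ Finset.Icc 1 p, (-1 : ℝ) ^ j * a (j - 1))
    (γ : ℕ → ℝ) (hγ : ∀ n : ℕ, γ n = ∑ j ∈ Finset.Icc 1 (n % p), (-1 : ℝ) ^ j * a (j - 1))
    (t : ℕ → ℝ) (ht0 : 0 < t 0)
    (htrec : ∀ n : ℕ, t (n + 1) = Real.exp (a n) / t n) :
    (∀ n : ℕ, t n = (t 0 * Real.exp (((n / p : ℕ) : ℝ) * σ + γ n)) ^ ((-1 : ℤ) ^ n)) ∧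
    ((∀ n : ℕ, t (n + p) = t n) ↔ σ = 0) ∧
    (σ = 0 ↔ ∑ i ∈ Finset.range (p / 2), a (2 * i) = ∑ i ∈ Finset.range (p / 2), a (2 * i + 1)) := by
  have hform := factor_eq_zpow_altSum htrec
  replace hσ : σ = altSum a p := hσ
  replace hγ : ∀ n, γ n = altSum a (n % p) := hγ
  refine ⟨fun n => ?_, ⟨fun h => ?_, fun h n => ?_⟩, ?_⟩
  · rw [hσ, hγ, ← altSum_mul_period_add heven hper, Nat.div_add_mod]
    exact hform n
  · have h0 := h 0
    rw [zero_add, hform p, heven.neg_one_pow, zpow_one, ← hσ] at h0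
    exact Real.exp_eq_one_iff σ |>.mp ((mul_eq_left₀ ht0.ne').mp h0)
  · rw [hform (n + p), hform n, altSum_add_period heven hper, ← hσ, h, zero_add, pow_add,
      heven.neg_one_pow, mul_one]
  · rw [hσ, ← Nat.two_mul_div_two_of_even heven, altSum_two_mul, sub_eq_zero, eq_comm,
      Nat.two_mul_div_two_of_even heven]
end
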